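/- Let L ⊆ A* be a factorial language and σ: A* → B* a substitution. If L is letter-balanced, then the language F(σ(L)) of factors of images of words of L is letter-balanced; more precisely, if L is letter-C-balanced then F(σ(L)) is letter-(2(1 + C·#A)·‖σ‖ − 2)-balanced. -/

import Mathlib

open List

/-- Number of occurrences of `v` as a factor of `w`, i.e. the number of
decompositions `w = p ++ v ++ s`. -/
def occ {A : Type*} [DecidableEq A] (v w : List A) : ℕ :=
  (List.range (w.length + 1)).countP (fun i => decide (v <+: w.drop i))

/-- Apply a substitution (given by its values on letters) to a word. -/
def applyS {A B : Type*} (σ : A → List B) (w : List A) : List B :=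
  (w.map σ).flatten

theorem occ_singleton {A : Type*} [DecidableEq A] (a : A) (w : List A) :
    occ [a] w = w.count a := by
  induction w with
  | nil => simp [occ]
  | cons x t ih =>
    rw [List.count_cons, ← ih, occ, occ, List.length_cons, List.range_succ_eq_map (n := t.length + 1),
      List.countP_cons, List.countP_map]
    congr 1
    simp [List.cons_prefix_cons, eq_comm (a := a) (b := x)]

theorem applyS_append {A B : Type*} (σ : A → List B) (u v : List A) :
    applyS σ (u ++ v) = applyS σ u ++ applyS σ v := by
  simp [applyS]

theorem applyS_cons {A B : Type*} (σ : A → List B) (a : A) (v : List A) :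
    applyS σ (a :: v) = σ a ++ applyS σ v := by
  simp [applyS]

/-- A prefix of `σ(y)` is the image of a prefix of `y` followed by a short word. -/
theorem exists_of_prefix_applyS {A B : Type*} {σ : A → List B} {M : ℕ} (hM : 0 < M)
    (hσ : ∀ a, (σ a).length ≤ M) {y : List A} {w : List B} (h : w <+: applyS σ y) :
    ∃ u p, u <+: y ∧ w = applyS σ u ++ p ∧ p.length < M := by
  induction y generalizing w with
  | nil =>
    obtain rfl : w = [] := by simpa [applyS] using h
    exact ⟨[], [], by simp, by simp [applyS], hM⟩
  | cons a y ih =>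
    rw [applyS_cons] at h
    rcases Nat.lt_or_ge w.length M with hw | hw
    · exact ⟨[], w, by simp, by simp [applyS], hw⟩
    · obtain ⟨r, rfl⟩ : σ a <+: w :=
        List.prefix_of_prefix_length_le (List.prefix_append _ _) h ((hσ a).trans hw)
      obtain ⟨u, p, hu, rfl, hp⟩ := ih ((List.prefix_append_right_inj _).1 h)
      exact ⟨a :: u, p, by simpa using hu, by simp [applyS_cons], hp⟩

/-- A factor of `σ(y)` is the image of a factor of `y`, up to a short word on each side. -/
theorem exists_of_infix_applyS {A B : Type*} {σ : A → List B} {M : ℕ} (hM : 0 < M)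
    (hσ : ∀ a, (σ a).length ≤ M) {y : List A} {w : List B} (h : w <:+: applyS σ y) :
    ∃ s u p, u <:+: y ∧ w = s ++ applyS σ u ++ p ∧ s.length < M ∧ p.length < M := by
  induction y generalizing w with
  | nil =>
    obtain rfl : w = [] := by simpa [applyS] using h
    exact ⟨[], [], [], by simp, by simp [applyS], hM, hM⟩
  | cons a y ih =>
    rcases Nat.lt_or_ge w.length M with hw | hw
    · exact ⟨w, [], [], by simp, by simp [applyS], hw, hM⟩
    have hpre {w : List B} (h : w <+: applyS σ (a :: y)) :
        ∃ s u p, u <:+: a :: y ∧ w = s ++ applyS σ u ++ p ∧ s.length < M ∧ p.length < M := by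
      obtain ⟨u, p, hu, rfl, hp⟩ := exists_of_prefix_applyS hM hσ h
      exact ⟨[], u, p, hu.isInfix, by simp, hM, hp⟩
    obtain ⟨l, r, hlr⟩ := h
    rcases Nat.eq_zero_or_pos l.length with hl | hl
    · obtain rfl := List.length_eq_zero_iff.1 hl
      exact hpre ⟨r, by simpa using hlr⟩
    rw [applyS_cons, List.append_assoc, List.append_eq_append_iff] at hlr
    rcases hlr with ⟨s, hs, hsr⟩ | ⟨c, rfl, hc⟩
    · have hsM : s.length < M := by
        have := hσ a
        rw [hs, List.length_append] at this
        omega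
      obtain ⟨q, rfl⟩ : s <+: w :=
        List.prefix_of_prefix_length_le ⟨_, hsr.symm⟩ (List.prefix_append w r) (hsM.le.trans hw)
      have hq : q <+: applyS σ y := ⟨r, by simpa using hsr⟩
      obtain ⟨u, p, hu, rfl, hp⟩ := exists_of_prefix_applyS hM hσ hq
      exact ⟨s, u, p, List.infix_cons hu.isInfix, by simp, hsM, hp⟩
    · obtain ⟨s, u, p, hu, hw', hs, hp⟩ := ih ⟨c, r, by simpa using hc.symm⟩
      exact ⟨s, u, p, List.infix_cons hu, hw', hs, hp⟩

theorem count_applyS {A B : Type*} [DecidableEq B] (σ : A → List B) (b : B) (u : List A) :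
    (applyS σ u).count b = (u.map fun a => (σ a).count b).sum := by
  simp [applyS, List.count_flatten, Function.comp_def]

theorem length_applyS {A B : Type*} (σ : A → List B) (u : List A) :
    (applyS σ u).length = (u.map fun a => (σ a).length).sum := by
  simp [applyS, List.length_flatten, Function.comp_def]

/-- Two words whose letter counts differ by at most `C` have close weights, for every weight
function bounded by `M`. -/
theorem abs_sum_map_sub_sum_map_le {A : Type*} [Fintype A] [DecidableEq A] {f : A → ℕ} {M C : ℕ}
    (hf : ∀ a, f a ≤ M) {u v : List A}
    (h : ∀ a, |(u.count a : ℤ) - (v.count a : ℤ)| ≤ C) :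
    |((u.map f).sum : ℤ) - ((v.map f).sum : ℤ)| ≤ C * Fintype.card A * M := by
  have key (w : List A) : ((w.map f).sum : ℤ) = ∑ a, (w.count a : ℤ) * f a := by
    rw [Finset.sum_list_map_count, Nat.cast_sum]
    simp only [smul_eq_mul, Nat.cast_mul]
    refine Finset.sum_subset (Finset.subset_univ _) fun a _ ha => ?_
    simp [List.count_eq_zero_of_not_mem (by simpa using ha)]
  rw [key, key, ← Finset.sum_sub_distrib]
  calc _ ≤ ∑ a, |(u.count a : ℤ) * f a - v.count a * f a| := Finset.abs_sum_le_sum_abs _ _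
    _ ≤ ∑ _a : A, (C * M : ℤ) := by
      refine Finset.sum_le_sum fun a _ => ?_
      rw [← sub_mul, abs_mul, Nat.abs_cast]
      exact mul_le_mul (h a) (mod_cast hf a) (by positivity) (by positivity)
    _ = _ := by
      simp only [Finset.sum_const, Finset.card_univ, nsmul_eq_mul]
      ring

/-- Words of equal length that are images of words of a balanced factorial language, up to short
words on both sides, have close letter counts. -/
theorem abs_count_sub_count_le {A B : Type*} [Fintype A] [DecidableEq A] [DecidableEq B]
    {L : Set (List A)} {C M : ℕ} {σ : A → List B}
    (hfac : ∀ w ∈ L, ∀ v : List A, v <:+: w → v ∈ L)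
    (hbal : ∀ a : A, ∀ w ∈ L, ∀ w' ∈ L, w.length = w'.length →
      |(w.count a : ℤ) - (w'.count a : ℤ)| ≤ (C : ℤ))
    (hσ : ∀ a, (σ a).length ≤ M) (b : B) {s p s' p' : List B} {u u' : List A}
    (hu : u ∈ L) (hu' : u' ∈ L) (hs : s.length < M) (hp : p.length < M)
    (huu' : u.length ≤ u'.length)
    (hlen : (s ++ applyS σ u ++ p).length = (s' ++ applyS σ u' ++ p').length) :
    |((s ++ applyS σ u ++ p).count b : ℤ) - ((s' ++ applyS σ u' ++ p').count b : ℤ)| ≤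
      2 * (C * Fintype.card A * M) + 2 * M - 2 := by
  obtain ⟨v, t, rfl, hv⟩ : ∃ v t, u' = v ++ t ∧ u.length = v.length :=
    ⟨u'.take u.length, u'.drop u.length, by simp, by simpa using huu'⟩
  have hbal' (a : A) : |(u.count a : ℤ) - (v.count a : ℤ)| ≤ C :=
    hbal a u hu v (hfac _ hu' _ (List.prefix_append v t).isInfix) hv
  have hcount := abs_sum_map_sub_sum_map_le
    (fun a => (List.count_le_length (a := b)).trans (hσ a)) hbal'
  have hlength := abs_sum_map_sub_sum_map_le hσ hbal'
  rw [← count_applyS, ← count_applyS] at hcount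
  rw [← length_applyS, ← length_applyS] at hlength
  have := List.count_le_length (a := b) (l := s)
  have := List.count_le_length (a := b) (l := p)
  have := List.count_le_length (a := b) (l := s')
  have := List.count_le_length (a := b) (l := p')
  have := List.count_le_length (a := b) (l := applyS σ t)
  simp only [applyS_append, List.count_append, List.length_append] at hlen ⊢
  rw [abs_le] at hcount hlength ⊢
  generalize (C * Fintype.card A * M : ℤ) = K at *
  omega

/-- if a factorial language `L` is letter-`C`-balanced, then the set of
factors of `σ(L)` is letter-`(2(1 + C·#A)·‖σ‖ - 2)`-balanced (in particular, it is
letter-balanced). -/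
theorem letter_balanced_image {A B : Type*} [Fintype A] [DecidableEq A] [DecidableEq B]
    (L : Set (List A)) (C : ℕ) (σ : A → List B)
    (hfac : ∀ w ∈ L, ∀ v : List A, v <:+: w → v ∈ L)
    (hbal : ∀ a : A, ∀ w ∈ L, ∀ w' ∈ L, w.length = w'.length →
      |(occ [a] w : ℤ) - (occ [a] w' : ℤ)| ≤ (C : ℤ)) :
    ∀ b : B, ∀ w ∈ {w : List B | ∃ y ∈ L, w <:+: applyS σ y},
      ∀ w' ∈ {w : List B | ∃ y ∈ L, w <:+: applyS σ y},
      w.length = w'.length →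
      |(occ [b] w : ℤ) - (occ [b] w' : ℤ)| ≤
        ((2 * (1 + C * Fintype.card A) * (Finset.univ.sup fun a : A => (σ a).length) - 2 : ℕ) : ℤ) := by
  intro b w hw w' hw' hlen
  simp only [occ_singleton] at hbal ⊢
  obtain ⟨y, hy, hwy⟩ := hw
  obtain ⟨y', hy', hwy'⟩ := hw'
  have hσ (a : A) : (σ a).length ≤ Finset.univ.sup fun a : A => (σ a).length :=
    Finset.le_sup (f := fun a : A => (σ a).length) (Finset.mem_univ a)
  generalize (Finset.univ.sup fun a : A => (σ a).length) = M at *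
  rcases Nat.eq_zero_or_pos M with rfl | hM
  · have hnil : applyS σ y = [] := by
      simpa [applyS] using fun a _ => List.length_eq_zero_iff.1 (Nat.le_zero.1 (hσ a))
    obtain rfl : w = [] := by simpa [hnil] using hwy
    obtain rfl : w' = [] := List.length_eq_zero_iff.1 hlen.symm
    simp
  obtain ⟨s, u, p, hu, rfl, hs, hp⟩ := exists_of_infix_applyS hM hσ hwy
  obtain ⟨s', u', p', hu', rfl, hs', hp'⟩ := exists_of_infix_applyS hM hσ hwy'
  have huL := hfac y hy u hu
  have huL' := hfac y' hy' u' hu'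
  have hbound : ((2 * (1 + C * Fintype.card A) * M - 2 : ℕ) : ℤ) =
      2 * (C * Fintype.card A * M) + 2 * M - 2 := by
    rw [Nat.cast_sub (by nlinarith [Nat.zero_le (C * Fintype.card A * M)])]
    push_cast
    ring
  rw [hbound]
  rcases Nat.le_total u.length u'.length with h | h
  · exact abs_count_sub_count_le hfac hbal hσ b huL huL' hs hp h hlen
  · rw [abs_sub_comm]
    exact abs_count_sub_count_le hfac hbal hσ b huL' huL hs' hp' h hlen.symm
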